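/- (Compatibility of the Yosida regularizations, Lemma 4.3.) Assume: β̂, β̂_Γ : ℝ → [0,+∞] are convex, proper, lower semicontinuous with β̂(0) = β̂_Γ(0) = 0; β := ∂β̂ and β_Γ := ∂β̂_Γ are their subdifferentials; D(β) ⊇ D(β_Γ); η > 0 and C_Γ ≥ 0 are constants such that |β°(r)| ≤ η|β_Γ°(r)| + C_Γ for every r ∈ D(β_Γ). Define β_ε := β^Y_ε and β_{Γ,ε} := (β_Γ)^Y_{εη}. Then for every ε > 0 and every r ∈ ℝ one has |β_ε(r)| ≤ η|β_{Γ,ε}(r)| + C_Γ. -/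

import Mathlib

/-- Convexity for an `EReal`-valued function on ℝ. -/
def ERealConvexOn (φ : ℝ → EReal) : Prop :=
  ∀ x y : ℝ, ∀ t : ℝ, 0 ≤ t → t ≤ 1 →
    φ (t * x + (1 - t) * y) ≤ (t : EReal) * φ x + ((1 - t : ℝ) : EReal) * φ y

/-- The subdifferential graph `∂φ ⊆ ℝ × ℝ` of `φ : ℝ → [0,+∞]`. -/
def subdiff (φ : ℝ → EReal) : Set (ℝ × ℝ) :=
  {p | φ p.1 ≠ ⊤ ∧ ∀ w : ℝ, φ p.1 + ((p.2 * (w - p.1) : ℝ) : EReal) ≤ φ w}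

/-- The minimal section `γ°(r)`: the element of `γ(r)` of minimum absolute value. -/
noncomputable def minSection (γ : Set (ℝ × ℝ)) (r : ℝ) : ℝ :=
  Classical.epsilon fun s => (r, s) ∈ γ ∧ ∀ t : ℝ, (r, t) ∈ γ → |s| ≤ |t|

/-- The resolvent value `(I + εγ)⁻¹(r)`: the (unique, by maximal monotonicity)
`y` with `(y, (r − y)/ε) ∈ γ`. -/
noncomputable def resolventPt (γ : Set (ℝ × ℝ)) (ε r : ℝ) : ℝ :=
  Classical.epsilon fun y => (y, (r - y) / ε) ∈ γ

/-- The Yosida approximation `γ^Y_ε(r) = (r − (I + εγ)⁻¹ r)/ε`. -/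
noncomputable def yosida (γ : Set (ℝ × ℝ)) (ε r : ℝ) : ℝ :=
  (r - resolventPt γ ε r) / ε

/-- The defining inequality of the subdifferential, between finite values. -/
lemma subdiff_toReal_le {φ : ℝ → EReal} (hnn : ∀ r, 0 ≤ φ r) {r s w : ℝ}
    (h : (r, s) ∈ subdiff φ) (hw : φ w ≠ ⊤) :
    (φ r).toReal + s * (w - r) ≤ (φ w).toReal := by
  have hbot : ∀ x, φ x ≠ ⊥ := fun x => (lt_of_lt_of_le EReal.bot_lt_zero (hnn x)).ne'
  have h1 := h.2 w
  have hr : φ r ≠ ⊤ := h.1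
  rw [← EReal.coe_toReal hr (hbot r), ← EReal.coe_toReal hw (hbot w)] at h1
  exact_mod_cast h1

lemma mem_subdiff_of_toReal {φ : ℝ → EReal} (hnn : ∀ r, 0 ≤ φ r) {r s : ℝ} (hr : φ r ≠ ⊤)
    (h : ∀ w, φ w ≠ ⊤ → (φ r).toReal + s * (w - r) ≤ (φ w).toReal) :
    (r, s) ∈ subdiff φ := by
  have hbot : ∀ x, φ x ≠ ⊥ := fun x => (lt_of_lt_of_le EReal.bot_lt_zero (hnn x)).ne'
  refine ⟨hr, fun w => ?_⟩
  by_cases hw : φ w = ⊤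
  · simp [hw]
  · have h1 := h w hw
    change φ r + ((s * (w - r) : ℝ) : EReal) ≤ φ w
    rw [← EReal.coe_toReal hr (hbot r), ← EReal.coe_toReal hw (hbot w)]
    exact_mod_cast h1

lemma subdiff_monotone {φ : ℝ → EReal} (hnn : ∀ r, 0 ≤ φ r) {r₁ s₁ r₂ s₂ : ℝ}
    (h₁ : (r₁, s₁) ∈ subdiff φ) (h₂ : (r₂, s₂) ∈ subdiff φ) :
    0 ≤ (s₁ - s₂) * (r₁ - r₂) := by
  have := subdiff_toReal_le hnn h₁ h₂.1
  have := subdiff_toReal_le hnn h₂ h₁.1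
  dsimp only at *
  linarith

lemma minSection_subdiff_spec {φ : ℝ → EReal} (hnn : ∀ r, 0 ≤ φ r) {r : ℝ}
    (h : ∃ t, (r, t) ∈ subdiff φ) :
    (r, minSection (subdiff φ) r) ∈ subdiff φ ∧
      ∀ t, (r, t) ∈ subdiff φ → |minSection (subdiff φ) r| ≤ |t| := by
  have hr : φ r ≠ ⊤ := h.choose_spec.1
  have hset : {s | (r, s) ∈ subdiff φ} =
      ⋂ w, ⋂ _ : φ w ≠ ⊤, {s : ℝ | (φ r).toReal + s * (w - r) ≤ (φ w).toReal} := by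
    ext s
    simp only [Set.mem_ofPred_eq, Set.mem_iInter]
    exact ⟨fun hs w hw => subdiff_toReal_le hnn hs hw, mem_subdiff_of_toReal hnn hr⟩
  have hclosed : IsClosed {s | (r, s) ∈ subdiff φ} := by
    rw [hset]
    exact isClosed_iInter fun w => isClosed_iInter fun _ =>
      isClosed_le (by fun_prop) continuous_const
  obtain ⟨s, hs, hmin⟩ := hclosed.exists_infDist_eq_dist h 0
  refine Classical.epsilon_spec
    (p := fun s => (r, s) ∈ subdiff φ ∧ ∀ t : ℝ, (r, t) ∈ subdiff φ → |s| ≤ |t|)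
    ⟨s, hs, fun t ht => ?_⟩
  have := Metric.infDist_le_dist_of_mem (s := {s | (r, s) ∈ subdiff φ}) (x := 0) ht
  rw [hmin] at this
  simpa [dist_comm, Real.dist_eq] using this

/-- The proximal functional `φ(w) + (w - r)² / (2ε)` attains its minimum. -/
lemma exists_prox_minimizer {φ : ℝ → EReal} (hnn : ∀ r, 0 ≤ φ r)
    (hlsc : LowerSemicontinuous φ) (hzero : φ 0 = 0) {ε : ℝ} (hε : 0 < ε) (r : ℝ) :
    ∃ y, ∀ w, φ y + (((y - r) ^ 2 / (2 * ε) : ℝ) : EReal) ≤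
      φ w + (((w - r) ^ 2 / (2 * ε) : ℝ) : EReal) := by
  have hq : LowerSemicontinuous fun w : ℝ => (((w - r) ^ 2 / (2 * ε) : ℝ) : EReal) :=
    (continuous_coe_real_ereal.comp (by fun_prop)).lowerSemicontinuous
  have hF : LowerSemicontinuous fun w : ℝ => φ w + (((w - r) ^ 2 / (2 * ε) : ℝ) : EReal) :=
    hlsc.add' hq fun w => EReal.continuousAt_add (Or.inr (EReal.coe_ne_bot _))
      (Or.inr (EReal.coe_ne_top _))
  have h0 : (0 : ℝ) ∈ Metric.closedBall r |r| := by simp [Real.dist_eq]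
  obtain ⟨y, -, hmin⟩ := (hF.lowerSemicontinuousOn (Metric.closedBall r |r|)).exists_isMinOn
    ⟨0, h0⟩ (isCompact_closedBall r |r|)
  refine ⟨y, fun w => ?_⟩
  by_cases hw : w ∈ Metric.closedBall r |r|
  · exact hmin hw
  · refine (hmin h0).trans ?_
    rw [Metric.mem_closedBall, Real.dist_eq, not_le] at hw
    have hsq : (0 - r) ^ 2 / (2 * ε) ≤ (w - r) ^ 2 / (2 * ε) := by
      gcongr ?_ / _
      rw [zero_sub, neg_sq]
      exact sq_le_sq.2 hw.le
    change φ 0 + (((0 - r) ^ 2 / (2 * ε) : ℝ) : EReal) ≤ _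
    rw [hzero]
    exact add_le_add (hnn w) (EReal.coe_le_coe_iff.2 hsq)

lemma resolventPt_subdiff_spec {φ : ℝ → EReal} (hnn : ∀ r, 0 ≤ φ r) (hconv : ERealConvexOn φ)
    (hlsc : LowerSemicontinuous φ) (hzero : φ 0 = 0) {ε : ℝ} (hε : 0 < ε) (r : ℝ) :
    (resolventPt (subdiff φ) ε r, yosida (subdiff φ) ε r) ∈ subdiff φ := by
  have hbot : ∀ x, φ x ≠ ⊥ := fun x => (lt_of_lt_of_le EReal.bot_lt_zero (hnn x)).ne'
  obtain ⟨y, hy⟩ := exists_prox_minimizer hnn hlsc hzero hε r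
  refine Classical.epsilon_spec (p := fun y => (y, (r - y) / ε) ∈ subdiff φ) ⟨y, ?_⟩
  have hytop : φ y ≠ ⊤ := by
    intro h
    have := hy 0
    rw [h, hzero, EReal.top_add_coe, zero_add] at this
    exact EReal.coe_ne_top _ (top_le_iff.1 this)
  refine mem_subdiff_of_toReal hnn hytop fun w hw => ?_
  have key : ∀ t ∈ Set.Ioo (0 : ℝ) 1, (φ y).toReal + (r - y) / ε * (w - y) ≤
      (φ w).toReal + t * ((w - y) ^ 2 / (2 * ε)) := by
    rintro t ⟨ht0, ht1⟩
    have h := (hy (t * w + (1 - t) * y)).trans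
      (add_le_add_left (hconv w y t ht0.le ht1.le) _)
    rw [← EReal.coe_toReal hytop (hbot y), ← EReal.coe_toReal hw (hbot w)] at h
    norm_cast at h
    refine le_of_mul_le_mul_left ?_ ht0
    have e : (t * w + (1 - t) * y - r) ^ 2 / (2 * ε) = (y - r) ^ 2 / (2 * ε)
        - t * ((r - y) / ε * (w - y)) + t * (t * ((w - y) ^ 2 / (2 * ε))) := by
      field_simp
      ring
    rw [e] at h
    linarith
  have hlim : Filter.Tendsto (fun t : ℝ => (φ w).toReal + t * ((w - y) ^ 2 / (2 * ε)))
      (nhdsWithin 0 (Set.Ioi 0)) (nhds ((φ w).toReal + 0 * ((w - y) ^ 2 / (2 * ε)))) :=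
    (Continuous.tendsto (by fun_prop) 0).mono_left nhdsWithin_le_nhds
  rw [zero_mul, add_zero] at hlim
  exact ge_of_tendsto hlim
    (Filter.mem_of_superset (Ioo_mem_nhdsGT zero_lt_one) key)

lemma zero_mem_subdiff {φ : ℝ → EReal} (hnn : ∀ r, 0 ≤ φ r) (hzero : φ 0 = 0) :
    ((0 : ℝ), (0 : ℝ)) ∈ subdiff φ :=
  ⟨by simp [hzero], fun w => by simpa [hzero] using hnn w⟩

/-- Let `y = r - a s` and `z = r - b t`, where `(y, s)` is monotone with respect to the origin
and to `(z, u)`. Either `z` lies strictly beyond `y` in the direction of `s`, and then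
`|s| ≤ |u|`, or `a |s| ≤ b |t|`. -/
lemma abs_le_or_abs_le_of_monotone {r y z s t u a b : ℝ} (hb : 0 < b)
    (hy : r - y = a * s) (hz : r - z = b * t) (hs : 0 ≤ s * y)
    (hu : 0 ≤ (u - s) * (z - y)) : a * |s| ≤ b * |t| ∨ |s| ≤ |u| := by
  rcases lt_trichotomy s 0 with h | h | h
  · have hy0 : y ≤ 0 := by nlinarith
    by_cases hyz : y ≤ z
    · left
      rw [abs_of_neg h]
      nlinarith [neg_le_abs t]
    · right
      have : u ≤ s := by nlinarith
      rw [abs_of_neg h, abs_of_nonpos (by linarith)]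
      linarith
  · simp [h]
  · have hy0 : 0 ≤ y := by nlinarith
    by_cases hyz : z ≤ y
    · left
      rw [abs_of_pos h]
      nlinarith [le_abs_self t]
    · right
      have : s ≤ u := by nlinarith
      rw [abs_of_pos h, abs_of_nonneg (by linarith)]
      linarith

/-- Lemma 4.3 (compatibility of the Yosida regularizations): with
`β_ε := β^Y_ε` and `β_{Γ,ε} := (β_Γ)^Y_{εη}`, under the compatibility assumptions
`D(β) ⊇ D(β_Γ)` and `|β°(r)| ≤ η|β_Γ°(r)| + C_Γ` on `D(β_Γ)`, one has
`|β_ε(r)| ≤ η|β_{Γ,ε}(r)| + C_Γ` for every `ε > 0` and every `r ∈ ℝ`. -/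
theorem yosida_compat (betaHat betaGammaHat : ℝ → EReal)
    (hnn : ∀ r : ℝ, 0 ≤ betaHat r) (hnnΓ : ∀ r : ℝ, 0 ≤ betaGammaHat r)
    (hconv : ERealConvexOn betaHat) (hconvΓ : ERealConvexOn betaGammaHat)
    (hlsc : LowerSemicontinuous betaHat) (hlscΓ : LowerSemicontinuous betaGammaHat)
    (hzero : betaHat 0 = 0) (hzeroΓ : betaGammaHat 0 = 0)
    (η CΓ : ℝ) (hη : 0 < η) (hCΓ : 0 ≤ CΓ)
    (hdom : ∀ r : ℝ, (∃ t : ℝ, (r, t) ∈ subdiff betaGammaHat) →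
      ∃ t : ℝ, (r, t) ∈ subdiff betaHat)
    (hcomp : ∀ r : ℝ, (∃ t : ℝ, (r, t) ∈ subdiff betaGammaHat) →
      |minSection (subdiff betaHat) r| ≤ η * |minSection (subdiff betaGammaHat) r| + CΓ) :
    ∀ ε : ℝ, 0 < ε → ∀ r : ℝ,
      |yosida (subdiff betaHat) ε r| ≤
        η * |yosida (subdiff betaGammaHat) (ε * η) r| + CΓ := by
  intro ε hε r
  have hεη : 0 < ε * η := mul_pos hε hη
  have hy := resolventPt_subdiff_spec hnn hconv hlsc hzero hε r
  have hz := resolventPt_subdiff_spec hnnΓ hconvΓ hlscΓ hzeroΓ hεη r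
  have hmin := (minSection_subdiff_spec hnn (hdom _ ⟨_, hz⟩)).1
  have hminΓ := (minSection_subdiff_spec hnnΓ ⟨_, hz⟩).2 _ hz
  rcases abs_le_or_abs_le_of_monotone hεη
      (mul_div_cancel₀ (r - resolventPt (subdiff betaHat) ε r) hε.ne').symm
      (mul_div_cancel₀ (r - resolventPt (subdiff betaGammaHat) (ε * η) r) hεη.ne').symm
      (by simpa [yosida] using subdiff_monotone hnn hy (zero_mem_subdiff hnn hzero))
      (subdiff_monotone hnn hmin hy) with h | h
  · have : |yosida (subdiff betaHat) ε r| ≤ η * |yosida (subdiff betaGammaHat) (ε * η) r| :=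
      le_of_mul_le_mul_left (h.trans_eq (mul_assoc ..)) hε
    linarith
  · calc |yosida (subdiff betaHat) ε r|
        ≤ |minSection (subdiff betaHat) (resolventPt (subdiff betaGammaHat) (ε * η) r)| := h
      _ ≤ η * |minSection (subdiff betaGammaHat)
            (resolventPt (subdiff betaGammaHat) (ε * η) r)| + CΓ := hcomp _ ⟨_, hz⟩
      _ ≤ η * |yosida (subdiff betaGammaHat) (ε * η) r| + CΓ := by gcongr
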